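/- For all integers d ≥ k ≥ 1, m*(k,d,k) = d. That is: every set of at most d points in ℝ^d has a complete Kneser (d−k)-transversal with respect to k, and there exists a set of d+1 points in ℝ^d (namely, d+1 affinely independent points) that has none. -/

import Mathlib

open Finset

noncomputable section

/-- Points of `ℝ^d`. -/
abbrev Pt (d : ℕ) : Type := Fin d → ℝ

/-- `L` is a complete Kneser `(d-λ)`-transversal of the finite point set `X` with respect
to `k`. -/
def IsCompleteKneserTransversal (k d lam : ℕ) (X : Finset (Pt d))
    (L : AffineSubspace ℝ (Pt d)) : Prop :=
  Module.finrank ℝ L.direction = d - lam ∧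
  (∃ T : Finset (Pt d), T ⊆ X ∧ T.card = d - lam + 1 ∧ (T : Set (Pt d)) ⊆ (L : Set (Pt d))) ∧
  ∀ Y : Finset (Pt d), Y ⊆ X → Y.card = k →
    ((convexHull ℝ (Y : Set (Pt d))) ∩ (L : Set (Pt d))).Nonempty

/-- `X` has a complete Kneser `(d-λ)`-transversal with respect to `k`. -/
def HasCKT (k d lam : ℕ) (X : Finset (Pt d)) : Prop :=
  ∃ L : AffineSubspace ℝ (Pt d), IsCompleteKneserTransversal k d lam X L

/-- The set of positive integers `n` such that every set of `n` points in `ℝ^d` has a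
complete Kneser `(d-λ)`-transversal with respect to `k`; `m*(k,d,λ)` is its maximum. -/
def mStarSet (k d lam : ℕ) : Set ℕ :=
  {n | 0 < n ∧ ∀ X : Finset (Pt d), X.card = n → HasCKT k d lam X}

/-- A subspace of a finite-dimensional space can be enlarged to one of any larger dimension. -/
theorem exists_le_finrank_eq {V : Type*} [AddCommGroup V] [Module ℝ V] [Module.Finite ℝ V]
    (W : Submodule ℝ V) {m : ℕ} (hW : Module.finrank ℝ W ≤ m) (hm : m ≤ Module.finrank ℝ V) :
    ∃ U : Submodule ℝ V, W ≤ U ∧ Module.finrank ℝ U = m := by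
  induction m, hW using Nat.le_induction with
  | base => exact ⟨W, le_rfl, rfl⟩
  | succ n _ ih =>
    obtain ⟨U, hWU, hU⟩ := ih (by omega)
    have hne : U ≠ ⊤ := by
      rintro rfl
      rw [finrank_top] at hU
      omega
    obtain ⟨v, -, hv⟩ := SetLike.exists_of_lt hne.lt_top
    exact ⟨U ⊔ Submodule.span ℝ {v}, hWU.trans le_sup_left, by
      rw [Submodule.finrank_sup_span_singleton hv, hU]⟩

/-- The affine span of `d - k + 1` of `d` points extends to a transversal, since every `k` of
the points include one of those chosen. -/
theorem hasCKT_of_card_eq {k d : ℕ} (hk : 1 ≤ k) (hkd : k ≤ d) (X : Finset (Pt d))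
    (hX : X.card = d) : HasCKT k d k X := by
  classical
  obtain ⟨T, hTX, hT⟩ := Finset.exists_subset_card_eq (s := X) (n := d - k + 1) (by omega)
  obtain ⟨p, hp⟩ : T.Nonempty := Finset.card_pos.1 (by omega)
  have hspan : Module.finrank ℝ (vectorSpan ℝ (T : Set (Pt d))) ≤ d - k := by
    have h := finrank_vectorSpan_image_finset_le ℝ id T hT
    rwa [Finset.image_id] at h
  obtain ⟨U, hU, hUd⟩ := exists_le_finrank_eq _ hspan (by simp)
  have hTL : (T : Set (Pt d)) ⊆ (AffineSubspace.mk' p U : Set (Pt d)) := fun q hq =>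
    AffineSubspace.mem_mk'.2 (hU (vsub_mem_vectorSpan ℝ hq hp))
  refine ⟨AffineSubspace.mk' p U, by rw [AffineSubspace.direction_mk', hUd],
    ⟨T, hTX, hT, hTL⟩, fun Y hYX hY => ?_⟩
  obtain ⟨q, hq⟩ : (Y ∩ T).Nonempty :=
    Finset.inter_nonempty_of_card_lt_card_add_card hYX hTX (by omega)
  rw [Finset.mem_inter] at hq
  exact ⟨q, subset_convexHull ℝ _ hq.1, hTL hq.2⟩

/-- More than `d` points in general position have no complete transversal. -/
theorem not_hasCKT_of_general_position {k d : ℕ} (hk : 1 ≤ k) (hkd : k ≤ d) (X : Finset (Pt d))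
    (hX : d + 1 ≤ X.card)
    (hgen : ∀ S ⊆ X, S.card = d + 1 → AffineIndependent ℝ (fun p : (S : Set (Pt d)) => (p : Pt d))) :
    ¬ HasCKT k d k X := by
  classical
  rintro ⟨L, hL, ⟨T, hTX, hT, hTL⟩, hY⟩
  obtain ⟨Y, hYX, hYc⟩ := Finset.exists_subset_card_eq (s := X \ T) (n := k) (by
    rw [Finset.card_sdiff_of_subset hTX]; omega)
  have hdisj : Disjoint Y T := Finset.disjoint_of_subset_left hYX Finset.sdiff_disjoint
  have hYX' : Y ⊆ X := hYX.trans Finset.sdiff_subset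
  have hind := hgen (Y ∪ T) (Finset.union_subset hYX' hTX) (by
    rw [Finset.card_union_of_disjoint hdisj]; omega)
  have himage : ∀ Z ⊆ Y ∪ T, (fun p : ((Y ∪ T : Finset (Pt d)) : Set (Pt d)) => (p : Pt d)) ''
      {p | (p : Pt d) ∈ Z} = (Z : Set (Pt d)) := by
    intro Z hZ
    ext q
    constructor
    · rintro ⟨p, hp, rfl⟩
      exact hp
    · exact fun hq => ⟨⟨q, hZ hq⟩, hq, rfl⟩
  have hspans := hind.affineSpan_disjoint_of_disjoint (s1 := {p | (p : Pt d) ∈ Y})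
    (s2 := {p | (p : Pt d) ∈ T})
    (Set.disjoint_left.2 fun p hpY hpT => Finset.disjoint_left.1 hdisj hpY hpT)
  rw [himage Y Finset.subset_union_left, himage T Finset.subset_union_right] at hspans
  have hTind : AffineIndependent ℝ (fun p : (T : Set (Pt d)) => (p : Pt d)) :=
    hind.mono (Finset.coe_subset.2 Finset.subset_union_right)
  have hTspan : affineSpan ℝ (T : Set (Pt d)) = L := by
    have := hTind.affineSpan_eq_of_le_of_card_eq_finrank_add_one (sp := L)
      (by simpa [affineSpan_le] using hTL) (by simp [hL, hT])
    simpa using this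
  obtain ⟨q, hqY, hqL⟩ := hY Y hYX' hYc
  rw [← hTspan] at hqL
  exact Set.disjoint_left.1 hspans (convexHull_subset_affineSpan _ hqY) hqL

/-- The moment curve `t ↦ (t, t², …, t^d)`. -/
def momentCurve (d : ℕ) (t : ℝ) : Pt d := fun j => t ^ ((j : ℕ) + 1)

theorem momentCurve_injective {d : ℕ} (hd : 1 ≤ d) : Function.Injective (momentCurve d) := by
  intro s t h
  simpa [momentCurve] using congrFun h ⟨0, hd⟩

theorem affineIndependent_momentCurve {d : ℕ} {t : Fin (d + 1) → ℝ} (ht : Function.Injective t) :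
    AffineIndependent ℝ (fun i => momentCurve d (t i)) := by
  rw [affineIndependent_iff_of_fintype]
  intro w hw hsum
  rw [Finset.weightedVSub_eq_linear_combination _ hw] at hsum
  refine congrFun (Matrix.eq_zero_of_forall_pow_sum_mul_pow_eq_zero ht fun i => ?_)
  refine Fin.cases (by simpa using hw) (fun j => ?_) i
  simpa [momentCurve] using congrFun hsum j

theorem affineIndependent_of_subset_momentCurve {d : ℕ} {S : Finset (Pt d)}
    (hS : (S : Set (Pt d)) ⊆ Set.range (momentCurve d)) (hcard : S.card = d + 1) :
    AffineIndependent ℝ (fun p : (S : Set (Pt d)) => (p : Pt d)) := by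
  let e : Fin (d + 1) ≃ (S : Set (Pt d)) := (S.equivFinOfCardEq hcard).symm
  choose t ht using fun i => hS (e i).2
  have htinj : Function.Injective t := fun i j hij =>
    e.injective (Subtype.ext (by rw [← ht i, ← ht j, hij]))
  rw [← affineIndependent_equiv e]
  convert affineIndependent_momentCurve htinj using 1
  exact funext fun i => (ht i).symm

/-- There are arbitrarily large finite sets on the moment curve. -/
theorem exists_subset_momentCurve {d : ℕ} (hd : 1 ≤ d) (n : ℕ) :
    ∃ X : Finset (Pt d), X.card = n ∧ (X : Set (Pt d)) ⊆ Set.range (momentCurve d) := by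
  obtain ⟨X, hX, hcard⟩ :=
    (Set.infinite_range_of_injective (momentCurve_injective hd)).exists_subset_card_eq n
  exact ⟨X, hcard, hX⟩

theorem not_hasCKT_of_subset_momentCurve {k d : ℕ} (hk : 1 ≤ k) (hkd : k ≤ d) {X : Finset (Pt d)}
    (hX : d + 1 ≤ X.card) (hcurve : (X : Set (Pt d)) ⊆ Set.range (momentCurve d)) :
    ¬ HasCKT k d k X :=
  not_hasCKT_of_general_position hk hkd X hX fun _ hS =>
    affineIndependent_of_subset_momentCurve ((Finset.coe_subset.2 hS).trans hcurve)

/-- for `d ≥ k ≥ 1`, `m*(k,d,k) = d`; moreover there is a set of `d+1`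
affinely independent points in `ℝ^d` with no complete Kneser `(d-k)`-transversal. -/
theorem mStar_k_eq_lambda (k d : ℕ) (hk : 1 ≤ k) (hkd : k ≤ d) :
    IsGreatest (mStarSet k d k) d ∧
    ∃ X : Finset (Pt d), X.card = d + 1 ∧
      AffineIndependent ℝ (fun p : (X : Set (Pt d)) => (p : Pt d)) ∧
      ¬ HasCKT k d k X := by
  have hd : 1 ≤ d := hk.trans hkd
  refine ⟨⟨⟨hd, hasCKT_of_card_eq hk hkd⟩, fun n hn => ?_⟩, ?_⟩
  · by_contra! hlt
    obtain ⟨X, hX, hcurve⟩ := exists_subset_momentCurve hd n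
    exact not_hasCKT_of_subset_momentCurve hk hkd (by omega) hcurve (hn.2 X hX)
  · obtain ⟨X, hX, hcurve⟩ := exists_subset_momentCurve hd (d + 1)
    exact ⟨X, hX, affineIndependent_of_subset_momentCurve hcurve hX,
      not_hasCKT_of_subset_momentCurve hk hkd hX.ge hcurve⟩
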